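/- If the graph (V, B_d ∪ B_r) is connected and B_d is nonempty, then there exist Laplacians D ∈ lap(V, B_d) and R ∈ lap(V, B_r) such that Re λ₂(D + iR) > 0. -/

import Mathlib

open Matrix Polynomial

/-- `G` is the incidence matrix of a graph: every column is `e_k - e_ℓ`
for some pair of distinct vertices `k, ℓ`. -/
def IsIncidence {q p : ℕ} (G : Matrix (Fin q) (Fin p) ℝ) : Prop :=
  ∀ j : Fin p, ∃ k ℓ : Fin q, k ≠ ℓ ∧
    ∀ i : Fin q, G i j = (if i = k then 1 else 0) - (if i = ℓ then 1 else 0)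

/-- The complex matrix `D + iR` built from two real matrices. -/
noncomputable def cM {q : ℕ} (D R : Matrix (Fin q) (Fin q) ℝ) :
    Matrix (Fin q) (Fin q) ℂ :=
  D.map (fun a => (a : ℂ)) + Complex.I • (R.map (fun a => (a : ℂ)))

/-- `Re λ₂(M) > 0`: at most one eigenvalue (with multiplicity), ordered by real
part, has nonpositive real part. -/
noncomputable def reLam2Pos {q : ℕ} (M : Matrix (Fin q) (Fin q) ℂ) : Prop :=
  (M.charpoly.roots.filter (fun μ : ℂ => μ.re ≤ 0)).card ≤ 1

/-- `Re λ₂(M) ≤ 0`: at least two eigenvalues (with multiplicity), ordered by real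
part, have nonpositive real part. -/
noncomputable def reLam2Nonpos {q : ℕ} (M : Matrix (Fin q) (Fin q) ℂ) : Prop :=
  2 ≤ (M.charpoly.roots.filter (fun μ : ℂ => μ.re ≤ 0)).card

/-- The weighted Laplacian `G Λ Gᵀ`. -/
def lapOf {q p : ℕ} (G : Matrix (Fin q) (Fin p) ℝ) (w : Fin p → ℝ) :
    Matrix (Fin q) (Fin q) ℝ :=
  G * diagonal w * Gᵀ


section absLemmas
set_option linter.unusedSectionVars false
variable {E : Type*} [NormedAddCommGroup E] [InnerProductSpace ℝ E] [FiniteDimensional ℝ E]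

lemma exists_eig (S : E →ₗ[ℝ] E) (hS : S.IsSymmetric) (W : Submodule ℝ E)
    (hW : ∀ v ∈ W, S v ∈ W) (b : E) (hb : ∃ u ∈ W, inner ℝ b u ≠ 0) :
    ∃ (l : ℝ) (v : E), v ∈ W ∧ S v = l • v ∧ inner ℝ b v ≠ 0 := by
  by_contra! hcon
  obtain ⟨u, huW, hu⟩ := hb
  have h1 := (hS.restrict_invariant hW).orthogonalComplement_iSup_eigenspaces_eq_bot
  rw [Submodule.orthogonal_eq_bot_iff] at h1
  have h2 : (⊤ : Submodule ℝ W) ≤ LinearMap.ker ((innerₛₗ ℝ b).comp W.subtype) := by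
    rw [← h1]
    refine iSup_le fun l v hv => ?_
    rw [Module.End.mem_eigenspace_iff] at hv
    have := hcon l v.1 v.2 (by simpa using congrArg Subtype.val hv)
    simpa using this
  have := h2 (show (⟨u, huW⟩ : W) ∈ ⊤ from trivial)
  exact hu (by simpa using this)

/-- largest invariant subspace in `K` -/
def unobs (R : E →ₗ[ℝ] E) (K : Submodule ℝ E) : Submodule ℝ E where
  carrier := {v | ∀ n : ℕ, (R ^ n) v ∈ K}
  add_mem' := by
    intro a b ha hb n
    rw [map_add]
    exact K.add_mem (ha n) (hb n)
  zero_mem' := by intro n; simp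
  smul_mem' := by
    intro c v hv n
    rw [map_smul]
    exact K.smul_mem _ (hv n)

lemma unobs_inv (R : E →ₗ[ℝ] E) (K : Submodule ℝ E) : ∀ v ∈ unobs R K, R v ∈ unobs R K := by
  intro v hv n
  have := hv (n + 1)
  rwa [pow_succ] at this

lemma unobs_le (R : E →ₗ[ℝ] E) (K : Submodule ℝ E) : unobs R K ≤ K := by
  intro v hv
  simpa using hv 0

lemma le_unobs (R : E →ₗ[ℝ] E) (K Y : Submodule ℝ E) (hY : Y ≤ K) (hi : ∀ v ∈ Y, R v ∈ Y) :
    Y ≤ unobs R K := by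
  intro v hv n
  apply hY
  induction n with
  | zero => simpa using hv
  | succ n ih =>
    rw [pow_succ']
    exact hi _ ih

lemma drop (R : E →ₗ[ℝ] E) (hR : R.IsSymmetric) (K : Submodule ℝ E) (b : E)
    (hb : b ∉ unobs R K) (hb' : ∃ u ∈ unobs R K, inner ℝ b u ≠ 0)
    (P : ℝ → E →ₗ[ℝ] E) (hP : ∀ t v, P t v = R v + (t * inner ℝ b v) • b) :
    ∃ t : ℝ, 0 < t ∧
      Module.finrank ℝ (unobs (P t) K) < Module.finrank ℝ (unobs R K) := by
  by_contra! hcon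
  have hPs : ∀ t, (P t).IsSymmetric := by
    intro t x y
    rw [hP, hP, inner_add_left, inner_add_right, inner_smul_left, inner_smul_right, hR x y,
      real_inner_comm b x]
    simp; ring
  have key : ∀ t : ℝ, 0 < t → ∃ (l : ℝ) (y : E), y ∈ K ∧ R y = l • y - b ∧
      inner ℝ b y = 1 / t := by
    intro t ht
    have h1 : ∃ u ∈ unobs (P t) K, inner ℝ b u ≠ 0 := by
      by_contra! h0
      have hle : unobs (P t) K ≤ unobs R K := by
        apply le_unobs _ _ _ (unobs_le _ _)
        intro v hv
        have := unobs_inv _ _ v hv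
        rw [hP, h0 v hv] at this
        simpa using this
      have heq := Submodule.eq_of_le_of_finrank_le hle (hcon t ht)
      obtain ⟨u, hu, hbu⟩ := hb'
      exact hbu (h0 u (heq ▸ hu))
    obtain ⟨l, v, hv, hev, hbv⟩ := exists_eig (P t) (hPs t) _ (unobs_inv _ _) b h1
    rw [hP] at hev
    have hc : t * inner ℝ b v ≠ 0 := mul_ne_zero ht.ne' hbv
    refine ⟨l, (t * inner ℝ b v)⁻¹ • v, K.smul_mem _ (unobs_le _ _ hv), ?_, ?_⟩
    · rw [map_smul, eq_sub_of_add_eq hev, smul_sub, smul_smul, smul_smul, inv_mul_cancel₀ hc,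
        one_smul, smul_comm, smul_smul]
    · rw [inner_smul_right]; field_simp
  choose! l y hyK hy hby using key
  have hinj : Set.InjOn l (Set.Ioi 0) := by
    intro s hs t ht hst
    have e1 := hR (y s) (y t)
    rw [hy s hs, hy t ht, inner_sub_left, inner_sub_right, inner_smul_left, inner_smul_right,
      hst, hby t ht, real_inner_comm b, hby s hs] at e1
    simp at e1
    exact e1.symm
  have hinf : (l '' Set.Ioi 0).Infinite := (Set.Ioi_infinite (0:ℝ)).image hinj
  set Y : Submodule ℝ E := Submodule.span ℝ (y '' Set.Ioi 0) with hYdef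
  have hYm : ∀ t, 0 < t → y t ∈ Y := fun t ht => Submodule.subset_span ⟨t, ht, rfl⟩
  by_cases hbY : b ∈ Y
  · apply hb
    refine le_unobs R K Y ?_ ?_ hbY
    · rw [hYdef, Submodule.span_le]
      rintro _ ⟨t, ht, rfl⟩
      exact hyK t ht
    · intro v hv
      have : Y ≤ Y.comap R := by
        conv_lhs => rw [hYdef]
        rw [Submodule.span_le]
        rintro _ ⟨t, ht, rfl⟩
        show R (y t) ∈ Y
        rw [hy t ht]
        exact Y.sub_mem (Y.smul_mem _ (hYm t ht)) hbY
      exact this hv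
  · obtain ⟨f, hf, hfY⟩ := Submodule.exists_dual_map_eq_bot_of_notMem hbY inferInstance
    have hf0 : ∀ t, 0 < t → f (y t) = 0 := by
      intro t ht
      have : f (y t) ∈ Y.map f := ⟨_, hYm t ht, rfl⟩
      rw [hfY] at this
      simpa using this
    let T : Module.End ℝ E := R - ((f b)⁻¹ • (f.comp R)).smulRight b
    have hT : ∀ t, 0 < t → T (y t) = l t • y t := by
      intro t ht
      simp only [T, LinearMap.sub_apply, LinearMap.smulRight_apply, LinearMap.smul_apply,
        LinearMap.comp_apply, hy t ht, map_sub, map_smul, hf0 t ht]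
      simp [hf]
    apply hinf
    refine (Module.End.finite_hasEigenvalue T).subset ?_
    rintro _ ⟨t, ht, rfl⟩
    refine Module.End.hasEigenvalue_of_hasEigenvector (x := y t) ⟨?_, ?_⟩
    · rw [Module.End.mem_eigenspace_iff]; exact hT t ht
    · intro h0
      have := hby t ht
      rw [h0, inner_zero_right] at this
      have ht' : (0:ℝ) < t := ht
      have : (0:ℝ) < 1 / t := by positivity
      linarith
end absLemmas

lemma lapOf_mulVec {q p : ℕ} (G : Matrix (Fin q) (Fin p) ℝ) (w : Fin p → ℝ) (v : Fin q → ℝ)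
    (i : Fin q) : (lapOf G w *ᵥ v) i = ∑ e, G i e * (w e * (Gᵀ *ᵥ v) e) := by
  unfold lapOf
  rw [← Matrix.mulVec_mulVec, ← Matrix.mulVec_mulVec]
  conv_lhs => rw [Matrix.mulVec, dotProduct]
  simp only [Matrix.mulVec_diagonal]

lemma incid_inner {q p p' : ℕ} (G : Matrix (Fin q) (Fin p) ℝ) (G' : Matrix (Fin q) (Fin p') ℝ)
    (hG : IsIncidence G) (hG' : IsIncidence G') (e : Fin p) (f : Fin p')
    (h : ∑ i, G i e * G' i f = 0) (i : Fin q) : G i e = 0 ∨ G' i f = 0 := by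
  obtain ⟨k, l, hkl, hk⟩ := hG e
  obtain ⟨m, n, hmn, hm⟩ := hG' f
  simp only [hk, hm] at h ⊢
  simp only [sub_mul, mul_sub, Finset.sum_sub_distrib, ite_mul, one_mul, zero_mul,
    Finset.sum_ite_eq', Finset.mem_univ, if_true] at h
  by_contra! hcon
  obtain ⟨h1, h2⟩ := hcon
  split_ifs at h h1 h2 <;> simp_all <;> norm_num at h

lemma incid_diff {q p : ℕ} (G : Matrix (Fin q) (Fin p) ℝ) (hG : IsIncidence G) (e : Fin p)
    (v : Fin q → ℝ) (c : ℝ) (h : ∀ i, G i e ≠ 0 → v i = c) : (Gᵀ *ᵥ v) e = 0 := by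
  obtain ⟨k, l, hkl, hk⟩ := hG e
  have h1 : v k = c := h k (by rw [hk]; simp [hkl])
  have h2 : v l = c := h l (by rw [hk]; simp [hkl.symm])
  simp only [Matrix.mulVec, dotProduct, Matrix.transpose_apply, hk, sub_mul,
    Finset.sum_sub_distrib, ite_mul, one_mul, zero_mul, Finset.sum_ite_eq', Finset.mem_univ,
    if_true, h1, h2, sub_self]

lemma incid_ex {q p : ℕ} (G : Matrix (Fin q) (Fin p) ℝ) (hG : IsIncidence G) (e : Fin p) :
    ∃ i, G i e ≠ 0 := by
  obtain ⟨k, l, hkl, hk⟩ := hG e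
  exact ⟨k, by rw [hk]; simp [hkl]⟩

lemma exists_wr {q pd pr : ℕ}
    (Gd : Matrix (Fin q) (Fin pd) ℝ) (Gr : Matrix (Fin q) (Fin pr) ℝ)
    (hGd : IsIncidence Gd) (hGr : IsIncidence Gr)
    (hconn : ∀ v : Fin q → ℝ, Gdᵀ.mulVec v = 0 → Grᵀ.mulVec v = 0 →
      ∃ c : ℝ, v = fun _ => c)
    (hpd : 0 < pd) :
    ∃ wr : Fin pr → ℝ, (∀ i, 0 < wr i) ∧ ∀ (v : Fin q → ℝ) (r : ℝ), Gdᵀ *ᵥ v = 0 →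
      lapOf Gr wr *ᵥ v = r • v → ∃ c : ℝ, v = fun _ => c := by
  classical
  let K : Submodule ℝ (EuclideanSpace ℝ (Fin q)) := LinearMap.ker ((Gdᵀ).mulVecLin ∘ₗ (WithLp.linearEquiv 2 ℝ (Fin q → ℝ)).toLinearMap)
  have hK : ∀ v : EuclideanSpace ℝ (Fin q), v ∈ K ↔ Gdᵀ *ᵥ v.ofLp = 0 := fun v => Iff.rfl
  let L : (Fin pr → ℝ) → EuclideanSpace ℝ (Fin q) →ₗ[ℝ] EuclideanSpace ℝ (Fin q) := fun w => Matrix.toEuclideanLin (lapOf Gr w)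
  have hL : ∀ w v, L w v = WithLp.toLp 2 (lapOf Gr w *ᵥ v.ofLp) := fun w v => rfl
  let b : Fin pr → EuclideanSpace ℝ (Fin q) := fun e => WithLp.toLp 2 (fun i => Gr i e)
  have hb : ∀ e v, inner ℝ (b e) v = (Grᵀ *ᵥ v.ofLp) e := by
    intro e v
    simp [b, PiLp.inner_apply, Matrix.mulVec, dotProduct, mul_comm]
  have hLsym : ∀ w, (L w).IsSymmetric := by
    intro w
    apply Matrix.isSymmetric_toEuclideanLin_iff.2
    unfold lapOf
    rw [Matrix.IsHermitian, Matrix.conjTranspose_eq_transpose_of_trivial]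
    simp [Matrix.transpose_mul, Matrix.mul_assoc]
  have hex : ∃ n : ℕ, ∃ w : Fin pr → ℝ, (∀ i, 0 < w i) ∧
      Module.finrank ℝ (unobs (L w) K) = n := ⟨_, fun _ => 1, fun _ => one_pos, rfl⟩
  obtain ⟨w, hw, hwn⟩ := Nat.find_spec hex
  have hmin : ∀ w', (∀ i, 0 < w' i) →
      ¬ Module.finrank ℝ (unobs (L w') K) < Module.finrank ℝ (unobs (L w) K) := by
    intro w' hw' hlt
    rw [hwn] at hlt
    exact Nat.find_min hex hlt ⟨w', hw', rfl⟩
  set U := unobs (L w) K with hU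
  have hdich : ∀ e, b e ∈ U ∨ ∀ u ∈ U, inner ℝ (b e) u = 0 := by
    intro e
    by_contra! hcon
    obtain ⟨h1, h2⟩ := hcon
    obtain ⟨t, ht, hlt⟩ := drop (L w) (hLsym w) K (b e) h1 h2
      (fun t => L (Function.update w e (w e + t))) (by
        intro t v
        rw [hL, hL, hb]
        ext i
        simp only [PiLp.add_apply, PiLp.smul_apply, lapOf_mulVec, b, smul_eq_mul]
        rw [← Finset.sum_erase_add _ _ (Finset.mem_univ e),
          ← Finset.sum_erase_add (a := e) _ (fun x => Gr i x * (w x * _)) (Finset.mem_univ e)]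
        rw [Finset.sum_congr rfl (g := fun x => Gr i x * (w x * (Grᵀ *ᵥ v.ofLp) x))]
        · simp; ring
        · intro x hx
          rw [Function.update_of_ne (Finset.ne_of_mem_erase hx)])
    refine hmin _ ?_ hlt
    intro i
    by_cases hi : i = e
    · subst hi; simp; have := hw i; linarith
    · simp [hi, hw]
  have hperp : ∀ e, ∀ u ∈ U, inner ℝ (b e) u = 0 := by
    by_contra! hcon
    obtain ⟨e₀, u₀, hu₀, he₀⟩ := hcon
    let A : Fin q → Prop := fun i => (∃ d, Gd i d ≠ 0) ∨
      ∃ e, (∀ u ∈ U, inner ℝ (b e) u = 0) ∧ Gr i e ≠ 0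
    have hF : ∀ e, b e ∈ U → ∀ i, Gr i e ≠ 0 → ¬ A i := by
      rintro e he i hi (⟨d, hd⟩ | ⟨e', he', hd⟩)
      · have h1 := congrFun ((hK _).1 (unobs_le _ _ he)) d
        have := incid_inner Gd Gr hGd hGr d e (by
          simpa [b, Matrix.mulVec, dotProduct] using h1) i
        tauto
      · have h1 := he' _ he
        rw [hb] at h1
        have := incid_inner Gr Gr hGr hGr e' e (by
          simpa [b, Matrix.mulVec, dotProduct] using h1) i
        tauto
    obtain ⟨c, hc⟩ := hconn (fun i => if A i then 1 else 0) (by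
      ext d
      apply incid_diff Gd hGd d _ 1
      intro i hi
      exact if_pos (Or.inl ⟨d, hi⟩)) (by
      ext e
      rcases hdich e with he | he
      · apply incid_diff Gr hGr e _ 0
        intro i hi
        exact if_neg (hF e he i hi)
      · apply incid_diff Gr hGr e _ 1
        intro i hi
        exact if_pos (Or.inr ⟨e, he, hi⟩))
    have he₀U : b e₀ ∈ U := by
      rcases hdich e₀ with h | h
      · exact h
      · exact absurd (h u₀ hu₀) he₀
    obtain ⟨i, hi⟩ := incid_ex Gr hGr e₀
    obtain ⟨j, hj⟩ := incid_ex Gd hGd ⟨0, hpd⟩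
    have c1 := congrFun hc i
    have c2 := congrFun hc j
    simp only [if_neg (hF e₀ he₀U i hi)] at c1
    rw [if_pos (show A j from Or.inl ⟨_, hj⟩)] at c2
    linarith
  refine ⟨w, hw, ?_⟩
  intro v r hv hr
  have hvU : (WithLp.toLp 2 v : EuclideanSpace ℝ (Fin q)) ∈ U := by
    refine le_unobs (L w) K (Submodule.span ℝ {WithLp.toLp 2 v}) ?_ ?_
      (Submodule.mem_span_singleton_self _)
    · rw [Submodule.span_singleton_le_iff_mem, hK]; exact hv
    · intro x hx
      obtain ⟨a, rfl⟩ := Submodule.mem_span_singleton.1 hx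
      rw [map_smul, hL]
      simp only [hr]
      rw [WithLp.toLp_smul]
      exact Submodule.smul_mem _ _ (Submodule.smul_mem _ _ (Submodule.mem_span_singleton_self _))
  apply hconn v hv
  ext e
  have := hperp e _ hvU
  rwa [hb] at this

lemma lapOf_quad {q p : ℕ} (G : Matrix (Fin q) (Fin p) ℝ) (w : Fin p → ℝ) (u v : Fin q → ℝ) :
    u ⬝ᵥ (lapOf G w *ᵥ v) = ∑ e, w e * ((Gᵀ *ᵥ u) e * (Gᵀ *ᵥ v) e) := by
  simp only [dotProduct, lapOf_mulVec, Finset.mul_sum]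
  rw [Finset.sum_comm]
  refine Finset.sum_congr rfl fun e _ => ?_
  have : (Gᵀ *ᵥ u) e = ∑ i, G i e * u i := rfl
  rw [this, Finset.sum_mul, Finset.mul_sum]
  refine Finset.sum_congr rfl fun i _ => ?_
  ring

lemma lapOf_symm {q p : ℕ} (G : Matrix (Fin q) (Fin p) ℝ) (w : Fin p → ℝ) (u v : Fin q → ℝ) :
    u ⬝ᵥ (lapOf G w *ᵥ v) = v ⬝ᵥ (lapOf G w *ᵥ u) := by
  rw [lapOf_quad, lapOf_quad]
  refine Finset.sum_congr rfl fun e _ => ?_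
  ring

lemma lapOf_zero {q p : ℕ} (G : Matrix (Fin q) (Fin p) ℝ) (w : Fin p → ℝ) (v : Fin q → ℝ)
    (h : Gᵀ *ᵥ v = 0) : lapOf G w *ᵥ v = 0 := by
  ext i
  rw [lapOf_mulVec, h]
  simp

lemma incid_const {q p : ℕ} (G : Matrix (Fin q) (Fin p) ℝ) (hG : IsIncidence G) (c : ℝ) :
    Gᵀ *ᵥ (fun _ => c) = 0 := by
  ext e
  exact incid_diff G hG e _ c (fun _ _ => rfl)

lemma lapOf_sum {q p : ℕ} (G : Matrix (Fin q) (Fin p) ℝ) (hG : IsIncidence G) (w : Fin p → ℝ)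
    (v : Fin q → ℝ) : ∑ i, (lapOf G w *ᵥ v) i = 0 := by
  have h := lapOf_symm G w (fun _ => 1) v
  rw [lapOf_zero G w _ (incid_const G hG 1)] at h
  simpa [dotProduct] using h

lemma cM_mulVec {q : ℕ} (D R : Matrix (Fin q) (Fin q) ℝ) (v : Fin q → ℂ) (i : Fin q) :
    (cM D R *ᵥ v) i = ⟨(D *ᵥ fun j => (v j).re) i - (R *ᵥ fun j => (v j).im) i,
      (D *ᵥ fun j => (v j).im) i + (R *ᵥ fun j => (v j).re) i⟩ := by
  apply Complex.ext
  · simp [cM, Matrix.mulVec, dotProduct, ← Finset.sum_sub_distrib]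
  · simp [cM, Matrix.mulVec, dotProduct, ← Finset.sum_add_distrib]

lemma eig_bad {q pd pr : ℕ}
    (Gd : Matrix (Fin q) (Fin pd) ℝ) (Gr : Matrix (Fin q) (Fin pr) ℝ)
    (hGr : IsIncidence Gr) (wd : Fin pd → ℝ) (hwd : ∀ i, 0 < wd i) (wr : Fin pr → ℝ)
    (H : ∀ (v : Fin q → ℝ) (r : ℝ), Gdᵀ *ᵥ v = 0 →
      lapOf Gr wr *ᵥ v = r • v → ∃ c : ℝ, v = fun _ => c)
    (v : Fin q → ℂ) (m : ℂ) (hm : m.re ≤ 0) (hv : v ≠ 0)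
    (hev : cM (lapOf Gd wd) (lapOf Gr wr) *ᵥ v = m • v) :
    m = 0 ∧ ∃ c : ℂ, v = fun _ => c := by
  set a : Fin q → ℝ := fun j => (v j).re with ha
  set b : Fin q → ℝ := fun j => (v j).im with hb
  set D := lapOf Gd wd with hD
  set R := lapOf Gr wr with hR
  have e1 : D *ᵥ a - R *ᵥ b = m.re • a - m.im • b := by
    ext i
    have := congrArg Complex.re (congrFun hev i)
    rw [cM_mulVec] at this
    simpa [a, b] using this
  have e2 : D *ᵥ b + R *ᵥ a = m.re • b + m.im • a := by
    ext i
    have := congrArg Complex.im (congrFun hev i)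
    rw [cM_mulVec] at this
    simpa [a, b] using this
  have f1 := congrArg (fun x => a ⬝ᵥ x) e1
  have f2 := congrArg (fun x => b ⬝ᵥ x) e2
  simp only [dotProduct_sub, dotProduct_add, dotProduct_smul, smul_eq_mul] at f1 f2
  have f3 : a ⬝ᵥ (R *ᵥ b) = b ⬝ᵥ (R *ᵥ a) := lapOf_symm _ _ _ _
  have f4 : a ⬝ᵥ b = b ⬝ᵥ a := dotProduct_comm _ _
  have quad : ∀ x : Fin q → ℝ, x ⬝ᵥ (D *ᵥ x) = ∑ e, wd e * (Gdᵀ *ᵥ x) e ^ 2 := by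
    intro x
    rw [hD, lapOf_quad]
    exact Finset.sum_congr rfl fun e _ => by ring
  have quad0 : ∀ x : Fin q → ℝ, 0 ≤ x ⬝ᵥ (D *ᵥ x) := by
    intro x
    rw [quad]
    exact Finset.sum_nonneg fun e _ => mul_nonneg (hwd e).le (sq_nonneg _)
  have quadz : ∀ x : Fin q → ℝ, x ⬝ᵥ (D *ᵥ x) = 0 → Gdᵀ *ᵥ x = 0 := by
    intro x hx
    rw [quad, Finset.sum_eq_zero_iff_of_nonneg
      (fun e _ => mul_nonneg (hwd e).le (sq_nonneg _))] at hx
    ext e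
    have := hx e (Finset.mem_univ _)
    simpa [(hwd e).ne'] using this
  have na : 0 ≤ a ⬝ᵥ a := Finset.sum_nonneg fun i _ => mul_self_nonneg _
  have nb : 0 ≤ b ⬝ᵥ b := Finset.sum_nonneg fun i _ => mul_self_nonneg _
  have tot : a ⬝ᵥ (D *ᵥ a) + b ⬝ᵥ (D *ᵥ b) = m.re * (a ⬝ᵥ a + b ⬝ᵥ b) := by
    rw [f3] at f1
    rw [f4] at f1
    linarith
  have tle : m.re * (a ⬝ᵥ a + b ⬝ᵥ b) ≤ 0 := mul_nonpos_of_nonpos_of_nonneg hm (by linarith)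
  have qa := quad0 a
  have qb := quad0 b
  have za := quadz a (by linarith)
  have zb := quadz b (by linarith)
  have hab : ¬ (a = 0 ∧ b = 0) := by
    rintro ⟨h1, h2⟩
    apply hv
    ext i
    exact Complex.ext (congrFun h1 i) (congrFun h2 i)
  have hpos : a ⬝ᵥ a + b ⬝ᵥ b ≠ 0 := by
    intro h
    exact hab ⟨dotProduct_self_eq_zero.1 (by linarith), dotProduct_self_eq_zero.1 (by linarith)⟩
  have hre : m.re = 0 := by
    have : m.re * (a ⬝ᵥ a + b ⬝ᵥ b) = 0 := by linarith
    exact (mul_eq_zero.1 this).resolve_right hpos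
  rw [hD, lapOf_zero Gd wd a za, hre] at e1
  rw [hD, lapOf_zero Gd wd b zb, hre] at e2
  have rb : R *ᵥ b = m.im • b := by simpa using e1
  have ra : R *ᵥ a = m.im • a := by simpa using e2
  obtain ⟨ca, hca⟩ := H a _ za ra
  obtain ⟨cb, hcb⟩ := H b _ zb rb
  have ra0 : R *ᵥ a = 0 := by rw [hca]; exact lapOf_zero _ _ _ (incid_const Gr hGr _)
  have rb0 : R *ᵥ b = 0 := by rw [hcb]; exact lapOf_zero _ _ _ (incid_const Gr hGr _)
  refine ⟨Complex.ext hre ?_, ⟨ca, cb⟩, ?_⟩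
  · by_contra him
    have him' : m.im ≠ 0 := him
    rw [ra0] at ra
    rw [rb0] at rb
    exact hab ⟨(smul_eq_zero.1 ra.symm).resolve_left him', (smul_eq_zero.1 rb.symm).resolve_left him'⟩
  · ext i
    exact Complex.ext (congrFun hca i) (congrFun hcb i)

/-- If the union graph is connected and the dissipative edge set is nonempty,
then some choice of Laplacians `D ∈ lap(V,B_d)`, `R ∈ lap(V,B_r)` satisfies
`Re λ₂(D + iR) > 0`. -/
theorem stmt14 {q pd pr : ℕ} (hq : 2 ≤ q)
    (Gd : Matrix (Fin q) (Fin pd) ℝ) (Gr : Matrix (Fin q) (Fin pr) ℝ)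
    (hGd : IsIncidence Gd) (hGr : IsIncidence Gr)
    (hconn : ∀ v : Fin q → ℝ, Gdᵀ.mulVec v = 0 → Grᵀ.mulVec v = 0 →
      ∃ c : ℝ, v = fun _ => c)
    (hpd : 0 < pd) :
    ∃ (wd : Fin pd → ℝ) (wr : Fin pr → ℝ),
      (∀ i, 0 < wd i) ∧ (∀ i, 0 < wr i) ∧
      reLam2Pos (cM (lapOf Gd wd) (lapOf Gr wr)) := by
  obtain ⟨wr, hwr, H⟩ := exists_wr Gd Gr hGd hGr hconn hpd
  refine ⟨fun _ => 1, wr, fun _ => one_pos, hwr, ?_⟩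
  have B := eig_bad Gd Gr hGr (fun _ => 1) (fun _ => one_pos) wr H
  set M := cM (lapOf Gd fun _ => 1) (lapOf Gr wr) with hM
  have hsum : ∀ v : Fin q → ℂ, ∑ i, (M *ᵥ v) i = 0 := by
    intro v
    simp only [hM, cM_mulVec]
    apply Complex.ext
    · simp only [Complex.re_sum, Finset.sum_sub_distrib, lapOf_sum Gd hGd, lapOf_sum Gr hGr]
      simp
    · simp only [Complex.im_sum, Finset.sum_add_distrib, lapOf_sum Gd hGd, lapOf_sum Gr hGr]
      simp
  have hker : ∀ (k : ℕ) (v : Fin q → ℂ), ((Matrix.toLin' M) ^ k) v = 0 →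
      ∃ c : ℂ, v = fun _ => c := by
    intro k
    induction k with
    | zero => intro v hv; exact ⟨0, (show v = 0 by simpa using hv)⟩
    | succ k ih =>
      intro v hv
      rw [pow_succ] at hv
      obtain ⟨c, hc⟩ := ih _ hv
      rw [Matrix.toLin'_apply] at hc
      have h0 := hsum v
      rw [hc] at h0
      have hq0 : (q : ℂ) ≠ 0 := by
        have : q ≠ 0 := by omega
        exact_mod_cast this
      have hc0 : c = 0 := by simpa [show q ≠ 0 by omega] using h0
      by_cases hv0 : v = 0
      · exact ⟨0, hv0⟩
      · refine (B v 0 le_rfl hv0 ?_).2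
        rw [hc, hc0]
        ext i
        simp
  have hmult : M.charpoly.rootMultiplicity 0 ≤ 1 := by
    rw [← Matrix.charpoly_toLin', ← LinearMap.finrank_maxGenEigenspace_eq]
    have hle : Module.End.maxGenEigenspace (Matrix.toLin' M) 0 ≤
        Submodule.span ℂ {(fun _ => 1 : Fin q → ℂ)} := by
      intro v hv
      rw [Module.End.mem_maxGenEigenspace] at hv
      obtain ⟨k, hk⟩ := hv
      rw [zero_smul, sub_zero] at hk
      obtain ⟨c, rfl⟩ := hker k v hk
      rw [Submodule.mem_span_singleton]
      exact ⟨c, by ext; simp⟩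
    exact (Submodule.finrank_mono hle).trans ((finrank_span_le_card _).trans (by simp))
  unfold reLam2Pos
  refine le_trans ?_ hmult
  rw [← Polynomial.count_roots, Multiset.count_eq_card_filter_eq]
  apply Multiset.card_le_card
  rw [Multiset.le_filter]
  refine ⟨Multiset.filter_le _ _, ?_⟩
  intro m hm
  rw [Multiset.mem_filter] at hm
  obtain ⟨hroot, hre⟩ := hm
  have hr := (Polynomial.mem_roots'.1 hroot).2
  rw [← Matrix.charpoly_toLin', ← Module.End.hasEigenvalue_iff_isRoot_charpoly] at hr
  obtain ⟨v, hv⟩ := hr.exists_hasEigenvector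
  have := hv.apply_eq_smul
  rw [Matrix.toLin'_apply] at this
  exact (B v m hre hv.2 this).1.symm
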